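/- Let (r_ℓ)_{ℓ≥1} be a sequence of positive real numbers with r_ℓ → ∞ and r_ℓ/ℓ → 0 as ℓ → ∞, let η₁ > 2 and 0 < η₂ < √2. Then there exist C > 0 and L ≥ 1 with the following property. Let ℓ ≥ L be an integer, let m be an integer with either ℓ − 2r_ℓ ≤ m ≤ ℓ − r_ℓ or r_ℓ ≤ m ≤ 2r_ℓ, and let I denote the interval (−η₂(r_ℓ/ℓ)^{1/2}, η₂(r_ℓ/ℓ)^{1/2}) in the first case and (−π/2 + η₁ r_ℓ/ℓ, π/2 − η₁ r_ℓ/ℓ) in the second case. Let v : (−π/2, π/2) → ℂ be twice differentiable with v''(θ) = Q_{ℓ,m}(θ) v(θ) for all θ. If ℓ + m is even, assume v'(0) = 0 and set c := |Q_{ℓ,m}(0)|^{1/4} v(0); if ℓ + m is odd, assume v(0) = 0 and set c := |Q_{ℓ,m}(0)|^{−1/4} v'(0). Then for all θ ∈ I one has |v(θ) − c · y_{ℓ,m}(θ)| ≤ C r_ℓ^{−1} |c| |Q_{ℓ,m}(θ)|^{−1/4}. -/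

import Mathlib

open Real Filter

noncomputable def Qlm (ℓ : ℕ) (m : ℤ) (θ : ℝ) : ℝ :=
  ((m : ℝ) ^ 2 - 1 / 4) / Real.cos θ ^ 2 - 1 / 4 - (ℓ : ℝ) * ((ℓ : ℝ) + 1)

noncomputable def Slm (ℓ : ℕ) (m : ℤ) (θ : ℝ) : ℝ :=
  ∫ t in (0:ℝ)..θ, Real.sqrt |Qlm ℓ m t|

/-- The WKB approximation `y_{ℓ,m}`. -/
noncomputable def ylm (ℓ : ℕ) (m : ℤ) (θ : ℝ) : ℝ :=
  if Even ((ℓ : ℤ) + m) then Real.cos (Slm ℓ m θ) / |Qlm ℓ m θ| ^ ((1:ℝ) / 4)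
  else Real.sin (Slm ℓ m θ) / |Qlm ℓ m θ| ^ ((1:ℝ) / 4)

open Set

/-- A Grönwall estimate with variable rate: the distance travelled from the initial value. -/
lemma norm_sub_le_exp_sub_one {E : Type*} [NormedAddCommGroup E] [NormedSpace ℝ E] {T : ℝ}
    (hT : 0 ≤ T) {f f' : ℝ → E} {G g : ℝ → ℝ}
    (hf : ∀ t ∈ Icc 0 T, HasDerivAt f (f' t) t)
    (hG : ∀ t ∈ Icc 0 T, HasDerivAt G (g t) t) (hG0 : G 0 = 0)
    (hb : ∀ t ∈ Icc 0 T, ∃ k ≥ 0, k < g t ∧ ‖f' t‖ ≤ k * ‖f t‖) :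
    ‖f T - f 0‖ ≤ ‖f 0‖ * (exp (G T) - 1) := by
  have key : ∀ ε > 0, ‖f T - f 0‖ ≤ (‖f 0‖ + ε) * exp (G T) - ‖f 0‖ := by
    intro ε hε
    have hB : ∀ t ∈ Icc 0 T, HasDerivAt (fun x => (‖f 0‖ + ε) * exp (G x) - ‖f 0‖)
        ((‖f 0‖ + ε) * (exp (G t) * g t)) t := fun t ht =>
      (((hG t ht).exp).const_mul _).sub_const _
    refine image_norm_le_of_norm_deriv_right_lt_deriv_boundary'
      (f := fun t => f t - f 0) (f' := f') (a := 0) (b := T)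
      (B := fun x => (‖f 0‖ + ε) * exp (G x) - ‖f 0‖)
      (B' := fun t => (‖f 0‖ + ε) * (exp (G t) * g t)) ?_ ?_ ?_ ?_ ?_ ?_ (right_mem_Icc.2 hT)
    · exact fun t ht => ((hf t ht).continuousAt.sub continuousAt_const).continuousWithinAt
    · exact fun t ht => ((hf t (Ico_subset_Icc_self ht)).sub_const _).hasDerivWithinAt
    · simp [hG0, hε.le]
    · exact fun t ht => (hB t ht).continuousAt.continuousWithinAt
    · exact fun t ht => (hB t (Ico_subset_Icc_self ht)).hasDerivWithinAt
    · intro t ht heq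
      obtain ⟨k, hk0, hk, hfk⟩ := hb t (Ico_subset_Icc_self ht)
      have h1 : ‖f t‖ ≤ (‖f 0‖ + ε) * exp (G t) := by
        have := norm_le_norm_add_norm_sub (f 0) (f t)
        rw [norm_sub_rev] at this
        linarith
      have hpos : 0 < (‖f 0‖ + ε) * exp (G t) := by positivity
      nlinarith [mul_le_mul_of_nonneg_left h1 hk0]
  have hlim : Tendsto (fun ε : ℝ => (‖f 0‖ + ε) * exp (G T) - ‖f 0‖) (nhdsWithin 0 (Ioi 0))
      (nhds (‖f 0‖ * (exp (G T) - 1))) := by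
    have : Continuous fun ε : ℝ => (‖f 0‖ + ε) * exp (G T) - ‖f 0‖ := by fun_prop
    have h := (this.tendsto 0).mono_left (nhdsWithin_le_nhds (s := Ioi 0))
    convert h using 2
    ring
  exact ge_of_tendsto hlim (eventually_mem_nhdsWithin.mono fun ε hε => key ε hε)

/-- The WKB approximation on `[0, T]` of a solution of the equation with potential `-P`, where `P`
is stationary at `0`; the error is controlled by a primitive `G` of a majorant `g` of the WKB error
density. -/
lemma wkb_estimate {T s : ℝ} (hT : 0 ≤ T) (hs : 0 < s) {P P' P'' S G g : ℝ → ℝ}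
    (hP : ∀ t ∈ Icc 0 T, HasDerivAt P (P' t) t) (hP' : ∀ t ∈ Icc 0 T, HasDerivAt P' (P'' t) t)
    (hsP : ∀ t ∈ Icc 0 T, s ^ 2 ≤ P t) (hP'0 : P' 0 = 0)
    (hS : ∀ t ∈ Icc 0 T, HasDerivAt S (√(P t)) t) (hS0 : S 0 = 0)
    (hG : ∀ t ∈ Icc 0 T, HasDerivAt G (g t) t) (hG0 : G 0 = 0)
    (hg : ∀ t ∈ Icc 0 T, |P'' t| / (4 * s ^ 3) + 5 * P' t ^ 2 / (16 * s ^ 5) < g t)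
    {v v' : ℝ → ℂ} (hv : ∀ t ∈ Icc 0 T, HasDerivAt v (v' t) t)
    (hv' : ∀ t ∈ Icc 0 T, HasDerivAt v' (-(P t : ℂ) * v t) t) {α β : ℂ}
    (hα : α = ((P 0 ^ ((1 : ℝ) / 4) : ℝ) : ℂ) * v 0)
    (hβ : β = ((P 0 ^ (-(1 : ℝ) / 4) : ℝ) : ℂ) * v' 0) :
    ‖((P T ^ ((1 : ℝ) / 4) : ℝ) : ℂ) * v T - (α * (cos (S T) : ℝ) + β * (sin (S T) : ℝ))‖ ≤
      2 * (max ‖α‖ ‖β‖ * (exp (2 * G T) - 1)) := by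
  have hPpos : ∀ t ∈ Icc 0 T, 0 < P t := fun t ht => (pow_pos hs 2).trans_le (hsP t ht)
  set q : ℝ → ℝ := fun t => P t ^ ((1 : ℝ) / 4) with hq
  have hqpos : ∀ t ∈ Icc 0 T, 0 < q t := fun t ht => rpow_pos_of_pos (hPpos t ht) _
  have hq4 : ∀ t ∈ Icc 0 T, q t ^ 4 = P t := fun t ht => by
    rw [hq, ← rpow_natCast, ← rpow_mul (hPpos t ht).le]; norm_num
  have hq2 : ∀ t ∈ Icc 0 T, √(P t) = q t ^ 2 := fun t ht => by
    rw [← hq4 t ht, show q t ^ 4 = (q t ^ 2) ^ 2 by ring, sqrt_sq (by positivity)]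
  have hqs : ∀ t ∈ Icc 0 T, s ≤ q t ^ 2 := fun t ht => by
    rw [← hq2 t ht]; exact le_sqrt_of_sq_le (hsP t ht)
  have hqd : ∀ t ∈ Icc 0 T, HasDerivAt q (P' t / (4 * q t ^ 3)) t := fun t ht => by
    have h := (hP t ht).rpow_const (p := 1 / 4) (Or.inl (hPpos t ht).ne')
    refine h.congr_deriv ?_
    have : P t ^ ((1 : ℝ) / 4 - 1) = (q t ^ 3)⁻¹ := by
      rw [hq, ← rpow_natCast, ← rpow_mul (hPpos t ht).le, ← rpow_neg (hPpos t ht).le]; norm_num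
    rw [this]
    have := (hqpos t ht).ne'
    field_simp
  set φ : ℝ → ℝ := fun t => P'' t / (4 * q t ^ 6) - 5 * P' t ^ 2 / (16 * q t ^ 10) with hφ
  set a : ℝ → ℂ := fun t => (q t : ℂ) * v t with ha
  set b : ℝ → ℂ := fun t => ((q t)⁻¹ : ℝ) * v' t + (P' t / (4 * q t ^ 5) : ℝ) * v t with hb
  have hader : ∀ t ∈ Icc 0 T, HasDerivAt a ((q t ^ 2 : ℝ) * b t) t ∧
      HasDerivAt b (-(q t ^ 2 : ℝ) * a t + φ t * a t) t := by
    intro t ht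
    have := hqpos t ht
    have hqdd := (hP' t ht).div (((hqd t ht).pow 5).const_mul 4) (by simp [this.ne'])
    have hqi := (hqd t ht).inv this.ne'
    have had := (hqd t ht).ofReal_comp.mul (hv t ht)
    have hbd := (hqi.ofReal_comp.mul (hv' t ht)).add (hqdd.ofReal_comp.mul (hv t ht))
    have hqC : (q t : ℂ) ≠ 0 := by exact_mod_cast this.ne'
    have had' : HasDerivAt a ((q t ^ 2 : ℝ) * b t) t := by
      refine had.congr_deriv ?_
      simp only [hb]
      push_cast
      field_simp
      ring
    have hbd' : HasDerivAt b (-(q t ^ 2 : ℝ) * a t + φ t * a t) t := by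
      refine hbd.congr_deriv ?_
      simp only [ha, hφ, ← hq4 t ht, Pi.pow_apply, Pi.inv_apply, Pi.div_apply]
      push_cast
      field_simp
      ring
    exact ⟨had', hbd'⟩
  have hφb : ∀ t ∈ Icc 0 T, |φ t| < g t := by
    intro t ht
    have := hqpos t ht
    refine lt_of_le_of_lt ?_ (hg t ht)
    have h6 : s ^ 3 ≤ q t ^ 6 := by
      calc s ^ 3 ≤ (q t ^ 2) ^ 3 := pow_le_pow_left₀ hs.le (hqs t ht) 3
        _ = _ := by ring
    have h10 : s ^ 5 ≤ q t ^ 10 := by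
      calc s ^ 5 ≤ (q t ^ 2) ^ 5 := pow_le_pow_left₀ hs.le (hqs t ht) 5
        _ = _ := by ring
    calc |φ t| ≤ |P'' t / (4 * q t ^ 6)| + |5 * P' t ^ 2 / (16 * q t ^ 10)| := abs_sub _ _
      _ = |P'' t| / (4 * q t ^ 6) + 5 * P' t ^ 2 / (16 * q t ^ 10) := by
        rw [abs_div, abs_of_pos (show 0 < 4 * q t ^ 6 by positivity),
          abs_of_nonneg (show 0 ≤ 5 * P' t ^ 2 / (16 * q t ^ 10) by positivity)]
      _ ≤ _ := by gcongr
  set A : ℝ → ℂ := fun t => a t * (cos (S t) : ℝ) - b t * (sin (S t) : ℝ) with hA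
  set B : ℝ → ℂ := fun t => a t * (sin (S t) : ℝ) + b t * (cos (S t) : ℝ) with hB
  have hsc : ∀ t, ((sin (S t) : ℝ) : ℂ) ^ 2 + ((cos (S t) : ℝ) : ℂ) ^ 2 = 1 := fun t => by
    exact_mod_cast sin_sq_add_cos_sq (S t)
  have haAB : ∀ t, a t = A t * (cos (S t) : ℝ) + B t * (sin (S t) : ℝ) := fun t => by
    simp only [hA, hB]
    linear_combination (-a t) * hsc t
  have hcomb : ∀ (x y : ℂ) (t : ℝ),
      ‖x * (cos (S t) : ℝ) + y * (sin (S t) : ℝ)‖ ≤ 2 * ‖(x, y)‖ := fun x y t => by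
    refine (norm_add_le _ _).trans ?_
    rw [norm_mul, norm_mul, Complex.norm_real, Complex.norm_real, two_mul]
    exact add_le_add
      ((mul_le_of_le_one_right (norm_nonneg _) (abs_cos_le_one _)).trans (norm_fst_le (x, y)))
      ((mul_le_of_le_one_right (norm_nonneg _) (abs_sin_le_one _)).trans (norm_snd_le (x, y)))
  have hfd : ∀ t ∈ Icc 0 T, HasDerivAt (fun t => (A t, B t))
      (-(φ t * a t * (sin (S t) : ℝ)), φ t * a t * (cos (S t) : ℝ)) t := by
    intro t ht
    obtain ⟨had, hbd⟩ := hader t ht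
    have hSt := hS t ht
    rw [hq2 t ht] at hSt
    refine HasDerivAt.prodMk
      (((had.mul hSt.cos.ofReal_comp).sub (hbd.mul hSt.sin.ofReal_comp)).congr_deriv ?_)
      (((had.mul hSt.sin.ofReal_comp).add (hbd.mul hSt.cos.ofReal_comp)).congr_deriv ?_)
    all_goals
      push_cast
      ring
  have hfb : ∀ t ∈ Icc 0 T, ∃ k ≥ 0, k < 2 * g t ∧
      ‖(-(φ t * a t * (sin (S t) : ℝ)), φ t * a t * (cos (S t) : ℝ))‖ ≤ k * ‖(A t, B t)‖ := by
    intro t ht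
    refine ⟨2 * |φ t|, by positivity, by linarith [hφb t ht], ?_⟩
    have h1 : ‖(φ t * a t : ℂ)‖ ≤ 2 * |φ t| * ‖(A t, B t)‖ := by
      have := hcomb (A t) (B t) t
      rw [← haAB] at this
      rw [norm_mul, Complex.norm_real, norm_eq_abs]
      nlinarith [mul_le_mul_of_nonneg_left this (abs_nonneg (φ t))]
    refine norm_prod_le_iff.2 ⟨?_, ?_⟩
    · rw [norm_neg, norm_mul, Complex.norm_real]
      exact (mul_le_of_le_one_right (norm_nonneg _) (abs_sin_le_one _)).trans h1
    · rw [norm_mul, Complex.norm_real]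
      exact (mul_le_of_le_one_right (norm_nonneg _) (abs_cos_le_one _)).trans h1
  have hmain := norm_sub_le_exp_sub_one hT hfd (fun t ht => (hG t ht).const_mul 2)
    (by simp [hG0]) hfb
  have hA0 : A 0 = α := by simp [hA, ha, hS0, hα, hq]
  have hB0 : B 0 = β := by
    have : (P 0 ^ ((1 : ℝ) / 4))⁻¹ = P 0 ^ (-(1 : ℝ) / 4) := by
      rw [neg_div, rpow_neg (hPpos 0 (left_mem_Icc.2 hT)).le]
    simp only [hB, hb, hq, hS0, hβ, hP'0, this]
    simp
  rw [Prod.mk_sub_mk, hA0, hB0, Prod.norm_mk α β] at hmain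
  have hfin := hcomb (A T - α) (B T - β) T
  calc _ = ‖(A T - α) * (cos (S T) : ℝ) + (B T - β) * (sin (S T) : ℝ)‖ := by
        congr 1
        linear_combination haAB T
    _ ≤ _ := hfin.trans (by gcongr)

/-- First derivative of `Qlm`. -/
noncomputable def Qlm' (m : ℤ) (θ : ℝ) : ℝ := 2 * ((m : ℝ) ^ 2 - 1 / 4) * sin θ / cos θ ^ 3

/-- Second derivative of `Qlm`. -/
noncomputable def Qlm'' (m : ℤ) (θ : ℝ) : ℝ :=
  2 * ((m : ℝ) ^ 2 - 1 / 4) * (cos θ ^ 2 + 3 * sin θ ^ 2) / cos θ ^ 4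

lemma hasDerivAt_Qlm (ℓ : ℕ) (m : ℤ) {θ : ℝ} (h : cos θ ≠ 0) :
    HasDerivAt (Qlm ℓ m) (Qlm' m θ) θ := by
  have := ((((hasDerivAt_cos θ).pow 2).fun_inv (by simpa using h)).const_mul
    ((m : ℝ) ^ 2 - 1 / 4)).sub_const (1 / 4) |>.sub_const ((ℓ : ℝ) * ((ℓ : ℝ) + 1))
  refine (this.congr_deriv ?_).congr_of_eventuallyEq (Eventually.of_forall fun x => ?_)
  · simp only [Qlm', Pi.pow_apply]
    field_simp
    norm_num
    ring
  · simp only [Qlm, Pi.pow_apply, div_eq_mul_inv]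

lemma hasDerivAt_Qlm' (m : ℤ) {θ : ℝ} (h : cos θ ≠ 0) :
    HasDerivAt (Qlm' m) (Qlm'' m θ) θ := by
  have := ((hasDerivAt_sin θ).const_mul (2 * ((m : ℝ) ^ 2 - 1 / 4))).fun_div
    ((hasDerivAt_cos θ).pow 3) (by simpa using h)
  refine this.congr_deriv ?_
  simp only [Qlm'', Pi.pow_apply]
  field_simp
  norm_num
  ring

lemma Qlm_neg (ℓ : ℕ) (m : ℤ) (θ : ℝ) : Qlm ℓ m (-θ) = Qlm ℓ m θ := by simp [Qlm]

lemma Slm_neg (ℓ : ℕ) (m : ℤ) (θ : ℝ) : Slm ℓ m (-θ) = -Slm ℓ m θ := by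
  have := intervalIntegral.integral_comp_neg (a := 0) (b := θ) fun t => √|Qlm ℓ m t|
  simp only [Qlm_neg, neg_zero] at this
  rw [Slm, Slm, this, intervalIntegral.integral_symm]

lemma ylm_neg (ℓ : ℕ) (m : ℤ) (θ : ℝ) :
    ylm ℓ m (-θ) = if Even ((ℓ : ℤ) + m) then ylm ℓ m θ else -ylm ℓ m θ := by
  simp only [ylm, Qlm_neg, Slm_neg, cos_neg, sin_neg, neg_div]
  split_ifs <;> rfl

lemma hasDerivAt_Slm (ℓ : ℕ) (m : ℤ) {θ : ℝ} (h : θ ∈ Ioo (-(π / 2)) (π / 2)) :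
    HasDerivAt (Slm ℓ m) (√|Qlm ℓ m θ|) θ := by
  have hc : ContinuousOn (fun t => √|Qlm ℓ m t|) (Ioo (-(π / 2)) (π / 2)) := fun t ht =>
    ((hasDerivAt_Qlm ℓ m (cos_pos_of_mem_Ioo ht).ne').continuousAt.abs.sqrt).continuousWithinAt
  have h0 : (0 : ℝ) ∈ Ioo (-(π / 2)) (π / 2) := by constructor <;> linarith [pi_pos]
  refine intervalIntegral.integral_hasDerivAt_right ?_
    (hc.stronglyMeasurableAtFilter isOpen_Ioo θ h) (hc.continuousAt (isOpen_Ioo.mem_nhds h))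
  exact (hc.mono (ordConnected_Ioo.uIcc_subset h0 h)).intervalIntegrable

/-- `-Qlm ℓ m` is bounded below on `[0, T]` and the total WKB error there is at most `E`. -/
def HasWKBErrorBound (ℓ : ℕ) (m : ℤ) (T E : ℝ) : Prop :=
  T < π / 2 ∧ ∃ s > 0, ∃ G g : ℝ → ℝ, G 0 = 0 ∧ G T ≤ E ∧ ∀ t ∈ Icc 0 T,
    HasDerivAt G (g t) t ∧ s ^ 2 ≤ -Qlm ℓ m t ∧
      |Qlm'' m t| / (4 * s ^ 3) + 5 * Qlm' m t ^ 2 / (16 * s ^ 5) < g t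

/-- The normalisation `c` of an even or odd solution `v`, according to the parity of `ℓ + m`. -/
def IsWKBNormalization (ℓ : ℕ) (m : ℤ) (v v' : ℝ → ℂ) (c : ℂ) : Prop :=
  (Even ((ℓ : ℤ) + m) ∧ v' 0 = 0 ∧ c = ((|Qlm ℓ m 0| ^ ((1:ℝ) / 4) : ℝ) : ℂ) * v 0) ∨
    (¬ Even ((ℓ : ℤ) + m) ∧ v 0 = 0 ∧ c = ((|Qlm ℓ m 0| ^ (-(1:ℝ) / 4) : ℝ) : ℂ) * v' 0)

lemma norm_sub_ylm_le_of_nonneg {ℓ : ℕ} {m : ℤ} {T E : ℝ} (hT : 0 ≤ T)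
    (hE : HasWKBErrorBound ℓ m T E) {v v' : ℝ → ℂ}
    (hv : ∀ θ ∈ Ioo (-(π / 2)) (π / 2), HasDerivAt v (v' θ) θ)
    (hv' : ∀ θ ∈ Ioo (-(π / 2)) (π / 2), HasDerivAt v' ((Qlm ℓ m θ : ℂ) * v θ) θ) {c : ℂ}
    (hc : IsWKBNormalization ℓ m v v' c) :
    ‖v T - c * (ylm ℓ m T : ℂ)‖ ≤
      2 * (‖c‖ * (exp (2 * E) - 1)) * |Qlm ℓ m T| ^ (-(1:ℝ) / 4) := by
  obtain ⟨hTpi, s, hs, G, g, hG0, hGT, hGg⟩ := hE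
  have hsub : ∀ t ∈ Icc 0 T, t ∈ Ioo (-(π / 2)) (π / 2) := fun t ht =>
    ⟨by linarith [pi_pos, ht.1], ht.2.trans_lt hTpi⟩
  have hcos : ∀ t ∈ Icc 0 T, cos t ≠ 0 := fun t ht => (cos_pos_of_mem_Ioo (hsub t ht)).ne'
  have habs : ∀ t ∈ Icc 0 T, |Qlm ℓ m t| = -Qlm ℓ m t := fun t ht =>
    abs_of_nonpos (by linarith [(hGg t ht).2.1, pow_pos hs 2])
  have h0T : (0 : ℝ) ∈ Icc 0 T := left_mem_Icc.2 hT
  have hTT : T ∈ Icc 0 T := right_mem_Icc.2 hT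
  have hpos : 0 < |Qlm ℓ m T| := by
    rw [habs T hTT]
    exact (pow_pos hs 2).trans_le (hGg T hTT).2.1
  have key := wkb_estimate hT hs (P := fun t => -Qlm ℓ m t) (P' := fun t => -Qlm' m t)
    (P'' := fun t => -Qlm'' m t) (S := Slm ℓ m) (G := G) (g := g)
    (fun t ht => (hasDerivAt_Qlm ℓ m (hcos t ht)).neg)
    (fun t ht => (hasDerivAt_Qlm' m (hcos t ht)).neg)
    (fun t ht => (hGg t ht).2.1) (by simp [Qlm'])
    (fun t ht => by simpa only [habs t ht] using hasDerivAt_Slm ℓ m (hsub t ht))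
    (by simp [Slm]) (fun t ht => (hGg t ht).1) hG0
    (fun t ht => by simpa only [abs_neg, neg_sq] using (hGg t ht).2.2)
    (fun t ht => hv t (hsub t ht))
    (fun t ht => (hv' t (hsub t ht)).congr_deriv (by push_cast; ring)) rfl rfl
  simp only [← habs T hTT, ← habs 0 h0T] at key
  have hexp : exp (2 * G T) - 1 ≤ exp (2 * E) - 1 := by gcongr
  set q : ℝ := |Qlm ℓ m T| ^ ((1:ℝ) / 4) with hq
  have hqpos : 0 < q := rpow_pos_of_pos hpos _
  have hqC : (q : ℂ) ≠ 0 := by exact_mod_cast hqpos.ne'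
  have hqinv : |Qlm ℓ m T| ^ (-(1:ℝ) / 4) = q⁻¹ := by rw [neg_div, rpow_neg hpos.le]
  rw [hqinv, ← div_eq_mul_inv, le_div_iff₀ hqpos]
  have hmul : ‖v T - c * (ylm ℓ m T : ℂ)‖ * q = ‖q * v T - c * ((q * ylm ℓ m T : ℝ) : ℂ)‖ := by
    rw [show (q * v T - c * ((q * ylm ℓ m T : ℝ) : ℂ)) = (v T - c * (ylm ℓ m T : ℂ)) * q by
      push_cast; ring, norm_mul, Complex.norm_real, norm_eq_abs, abs_of_pos hqpos]
  rw [hmul]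
  rcases hc with ⟨hev, h0, hc⟩ | ⟨hev, h0, hc⟩
  · have hy : q * ylm ℓ m T = cos (Slm ℓ m T) := by
      rw [ylm, if_pos hev, ← hq]
      field_simp
    rw [h0, ← hc] at key
    simp only [mul_zero, norm_zero, zero_mul, add_zero, norm_nonneg, sup_of_le_left] at key
    rw [hy]
    exact key.trans (by gcongr)
  · have hy : q * ylm ℓ m T = sin (Slm ℓ m T) := by
      rw [ylm, if_neg hev, ← hq]
      field_simp
    rw [h0, ← hc] at key
    simp only [mul_zero, norm_zero, zero_mul, zero_add, norm_nonneg, sup_of_le_right] at key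
    rw [hy]
    exact key.trans (by gcongr)

lemma norm_sub_ylm_le {ℓ : ℕ} {m : ℤ} {θ E : ℝ} (hE : HasWKBErrorBound ℓ m |θ| E)
    {v v' : ℝ → ℂ} (hv : ∀ θ ∈ Ioo (-(π / 2)) (π / 2), HasDerivAt v (v' θ) θ)
    (hv' : ∀ θ ∈ Ioo (-(π / 2)) (π / 2), HasDerivAt v' ((Qlm ℓ m θ : ℂ) * v θ) θ) {c : ℂ}
    (hc : IsWKBNormalization ℓ m v v' c) :
    ‖v θ - c * (ylm ℓ m θ : ℂ)‖ ≤
      2 * (‖c‖ * (exp (2 * E) - 1)) * |Qlm ℓ m θ| ^ (-(1:ℝ) / 4) := by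
  rcases le_or_gt 0 θ with h | h
  · rw [abs_of_nonneg h] at hE
    exact norm_sub_ylm_le_of_nonneg h hE hv hv' hc
  rw [abs_of_neg h] at hE
  have hmem : ∀ t ∈ Ioo (-(π / 2)) (π / 2), -t ∈ Ioo (-(π / 2)) (π / 2) := fun t ht =>
    ⟨by linarith [ht.2], by linarith [ht.1]⟩
  have hd : ∀ t ∈ Ioo (-(π / 2)) (π / 2), HasDerivAt (fun x => v (-x)) (-v' (-t)) t :=
    fun t ht => by
    simpa [Function.comp_def] using (hv (-t) (hmem t ht)).scomp t (hasDerivAt_neg t)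
  have hd' : ∀ t ∈ Ioo (-(π / 2)) (π / 2),
      HasDerivAt (fun x => v' (-x)) (-((Qlm ℓ m t : ℂ) * v (-t))) t := fun t ht => by
    simpa [Qlm_neg, Function.comp_def] using (hv' (-t) (hmem t ht)).scomp t (hasDerivAt_neg t)
  rcases id hc with ⟨hev, h0, hc⟩ | ⟨hev, h0, hc⟩
  · have := norm_sub_ylm_le_of_nonneg (v := fun x => v (-x)) (v' := fun x => -v' (-x)) (c := c)
      (by linarith) hE hd (fun t ht => by simpa using (hd' t ht).fun_neg)
      (Or.inl ⟨hev, by simp [h0], by simpa using hc⟩)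
    simpa [ylm_neg, hev, Qlm_neg] using this
  · have := norm_sub_ylm_le_of_nonneg (v := fun x => -v (-x)) (v' := fun x => v' (-x)) (c := c)
      (by linarith) hE (fun t ht => by simpa using (hd t ht).fun_neg)
      (fun t ht => by simpa using hd' t ht)
      (Or.inr ⟨hev, by simp [h0], by simpa using hc⟩)
    have e : -v (- -θ) - c * (ylm ℓ m (-θ) : ℂ) = -(v θ - c * (ylm ℓ m θ : ℂ)) := by
      rw [ylm_neg, if_neg hev, neg_neg]
      push_cast
      ring
    rwa [e, norm_neg, Qlm_neg] at this

lemma HasWKBErrorBound.mono {ℓ : ℕ} {m : ℤ} {T E E' : ℝ} (h : HasWKBErrorBound ℓ m T E)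
    (hE : E ≤ E') : HasWKBErrorBound ℓ m T E' := by
  obtain ⟨hT, s, hs, G, g, hG0, hG, hg⟩ := h
  exact ⟨hT, s, hs, G, g, hG0, hG.trans hE, hg⟩

lemma abs_Qlm''_le {m : ℤ} {M t : ℝ} (h0 : 1 / 4 ≤ (m : ℝ) ^ 2) (hM : (m : ℝ) ^ 2 ≤ M)
    (h : cos t ≠ 0) : |Qlm'' m t| ≤ 6 * M / cos t ^ 4 := by
  have h4 : 0 < cos t ^ 4 := by positivity
  have h1 := sin_sq_add_cos_sq t
  rw [Qlm'', abs_div, abs_of_pos h4, abs_of_nonneg (mul_nonneg (by linarith) (by positivity))]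
  refine div_le_div_of_nonneg_right ?_ h4.le
  nlinarith [sq_nonneg (sin t), sq_nonneg (cos t)]

lemma sq_Qlm'_le {m : ℤ} {M t : ℝ} (h0 : 1 / 4 ≤ (m : ℝ) ^ 2) (hM : (m : ℝ) ^ 2 ≤ M) :
    Qlm' m t ^ 2 ≤ 4 * M ^ 2 * sin t ^ 2 / cos t ^ 6 := by
  have h6 : 0 ≤ cos t ^ 6 := Even.pow_nonneg (by decide) _
  rw [Qlm', div_pow, ← pow_mul, mul_pow, mul_pow]
  norm_num
  gcongr
  linarith

set_option maxHeartbeats 800000 in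
/-- Error bound near the equator, when `m` is within `2 R` of `ℓ`. -/
lemma hasWKBErrorBound_of_near {ℓ : ℕ} {m : ℤ} {R w k η T : ℝ} (hw : 0 < w)
    (hRw : R = ℓ * w ^ 2) (hk : 0 < k) (hη : 0 < η) (hkη : η ^ 2 = 2 - 2 * k ^ 2) (hR : 1 ≤ R)
    (hRℓ : 6 * R ≤ k ^ 2 * ℓ) (hm : (ℓ : ℝ) - 2 * R ≤ m) (hm' : (m : ℝ) ≤ ℓ - R) (hT0 : 0 ≤ T)
    (hT : T ≤ η * w) :
    HasWKBErrorBound ℓ m T (η * (25 / (4 * k ^ 3) + 20 / k ^ 5) / R) := by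
  set n : ℝ := (ℓ : ℝ) with hn
  have hk1 : k ^ 2 < 1 := by nlinarith [pow_pos hη 2]
  have hn0 : 0 < n := by
    by_contra! h
    nlinarith [sq_nonneg w]
  have hRn : 6 * R ≤ n := by nlinarith
  have hw2 : 6 * w ^ 2 ≤ 1 := by nlinarith
  have hη2 : η ^ 2 ≤ 2 := by nlinarith [sq_nonneg k]
  have hTw : T ^ 2 ≤ η ^ 2 * w ^ 2 := by
    rw [← mul_pow]
    gcongr
  have hT3 : T ^ 2 ≤ 1 / 3 := by nlinarith [sq_nonneg w]
  have hT1 : T < 1 := by nlinarith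
  have hm0 : 4 ≤ (m : ℝ) := by linarith
  have hmM : (m : ℝ) ^ 2 ≤ n ^ 2 := by
    gcongr
    linarith
  have hmM' : (m : ℝ) ^ 2 ≤ (n - R) ^ 2 := pow_le_pow_left₀ (by linarith) hm' 2
  have hm4 : 1 / 4 ≤ (m : ℝ) ^ 2 := by nlinarith
  refine ⟨by linarith [pi_gt_three], k * n * w, by positivity,
    fun t => (25 * n ^ 2 / (4 * (k * n * w) ^ 3) + 20 * n ^ 3 * R / (k * n * w) ^ 5) * t,
    fun _ => 25 * n ^ 2 / (4 * (k * n * w) ^ 3) + 20 * n ^ 3 * R / (k * n * w) ^ 5,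
    by simp, ?_, fun t ht => ⟨?_, ?_, ?_⟩⟩
  · calc _ ≤ (25 * n ^ 2 / (4 * (k * n * w) ^ 3) + 20 * n ^ 3 * R / (k * n * w) ^ 5) *
          (η * w) := mul_le_mul_of_nonneg_left hT (by positivity)
      _ = _ := by
        rw [hRw]
        field_simp
  · simpa using (hasDerivAt_id t).const_mul
      (25 * n ^ 2 / (4 * (k * n * w) ^ 3) + 20 * n ^ 3 * R / (k * n * w) ^ 5)
  all_goals
    have htT : t ^ 2 ≤ T ^ 2 := pow_le_pow_left₀ ht.1 ht.2 2
    have hsin : sin t ^ 2 ≤ t ^ 2 :=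
      pow_le_pow_left₀ (sin_nonneg_of_nonneg_of_le_pi ht.1 (by linarith [pi_gt_three, ht.2]))
        (sin_le ht.1) 2
    have hsc := sin_sq_add_cos_sq t
    have hc2 : 2 / 3 ≤ cos t ^ 2 := by linarith
    have hc0 : cos t ≠ 0 := fun h => by norm_num [h] at hc2
  · have hc2pos : 0 < cos t ^ 2 := by positivity
    have hs2 : (k * n * w) ^ 2 = k ^ 2 * n * R := by rw [hRw]; ring
    have htn : t ^ 2 * n ≤ η ^ 2 * R := by rw [hRw]; nlinarith
    have hmain : ((m : ℝ) ^ 2 - 1 / 4) / cos t ^ 2 ≤ n * (n + 1) + 1 / 4 - k ^ 2 * n * R := by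
      rw [div_le_iff₀ hc2pos]
      have hY : 0 ≤ n * (n + 1) + 1 / 4 - k ^ 2 * n * R := by
        nlinarith [mul_le_mul hk1.le hRn (by positivity) zero_le_one]
      have h1 : (n * (n + 1) + 1 / 4 - k ^ 2 * n * R) * (1 - t ^ 2) ≤
          (n * (n + 1) + 1 / 4 - k ^ 2 * n * R) * cos t ^ 2 :=
        mul_le_mul_of_nonneg_left (by linarith) hY
      refine le_trans ?_ h1
      have h2 : (n * (n + 1) + 1 / 4 - k ^ 2 * n * R) * t ^ 2 ≤ (n + 2) * (η ^ 2 * R) := by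
        calc _ ≤ (n * (n + 2)) * t ^ 2 := by
              gcongr
              have : 0 ≤ k ^ 2 * n * R := by positivity
              linarith
          _ = (n + 2) * (t ^ 2 * n) := by ring
          _ ≤ _ := by gcongr
      have h3 : 0 ≤ R * (k ^ 2 * n - R - 2 * η ^ 2) := mul_nonneg (by linarith) (by linarith)
      rw [hkη] at h2 h3
      linarith
    rw [hs2, Qlm]
    linarith
  · have h4 : (2 / 3) ^ 2 ≤ cos t ^ 4 := by
      calc _ ≤ (cos t ^ 2) ^ 2 := by gcongr
        _ = _ := by ring
    have h6 : (2 / 3) ^ 3 ≤ cos t ^ 6 := by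
      calc _ ≤ (cos t ^ 2) ^ 3 := by gcongr
        _ = _ := by ring
    have hQ2 : |Qlm'' m t| ≤ 24 * n ^ 2 := by
      refine (abs_Qlm''_le hm4 hmM hc0).trans ?_
      rw [div_le_iff₀ (by positivity)]
      nlinarith [mul_le_mul_of_nonneg_left h4 (sq_nonneg n)]
    have hQ1 : Qlm' m t ^ 2 ≤ 64 * n ^ 3 * R := by
      refine (sq_Qlm'_le hm4 hmM).trans ?_
      rw [div_le_iff₀ (by positivity)]
      have : sin t ^ 2 ≤ 2 * w ^ 2 := by nlinarith [sq_nonneg w]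
      calc 4 * (n ^ 2) ^ 2 * sin t ^ 2 ≤ 4 * (n ^ 2) ^ 2 * (2 * w ^ 2) := by gcongr
        _ = 8 * n ^ 3 * R := by rw [hRw]; ring
        _ ≤ 64 * n ^ 3 * R * (2 / 3) ^ 3 := by
          have : 0 ≤ n ^ 3 * R := by positivity
          linarith
        _ ≤ _ := by gcongr
    have hlt : |Qlm'' m t| < 25 * n ^ 2 := hQ2.trans_lt (by nlinarith)
    have h5 : 5 * Qlm' m t ^ 2 / (16 * (k * n * w) ^ 5) ≤ 20 * n ^ 3 * R / (k * n * w) ^ 5 := by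
      calc _ ≤ 5 * (64 * n ^ 3 * R) / (16 * (k * n * w) ^ 5) := by gcongr
        _ = _ := by field_simp; norm_num
    exact add_lt_add_of_lt_of_le (by gcongr) h5

/-- Error bound away from the poles, when `m` is between `R` and `2 R`. -/
lemma hasWKBErrorBound_of_far {ℓ : ℕ} {m : ℤ} {R k β T : ℝ} (hk : 0 < k) (hβ : 2 < β)
    (hkβ : k ^ 2 = 1 - 4 / β ^ 2) (hR : 1 ≤ R) (hℓ : 0 < ℓ) (hm : R ≤ m) (hm' : (m : ℝ) ≤ 2 * R)
    (hT0 : 0 ≤ T) (hT : T < π / 2) (hc : β * R ≤ ℓ * cos T) :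
    HasWKBErrorBound ℓ m T ((7 / (4 * k ^ 3) + 5 / (4 * k ^ 5)) / R) := by
  set n : ℝ := (ℓ : ℝ) with hn
  have hn0 : 0 < n := Nat.cast_pos.2 hℓ
  have hmM : (m : ℝ) ^ 2 ≤ (2 * R) ^ 2 := by
    gcongr
    linarith
  have hm4 : 1 / 4 ≤ (m : ℝ) ^ 2 := by nlinarith
  set D : ℝ := 7 / (4 * k ^ 3) + 5 / (4 * k ^ 5) with hD
  have hDpos : 0 < D := by positivity
  have hcT : 0 < cos T := cos_pos_of_mem_Ioo ⟨by linarith [pi_pos], hT⟩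
  refine ⟨hT, k * n, by positivity, fun t => D / n * tan t, fun t => D / n * (1 / cos t ^ 2),
    by simp, ?_, fun t ht => ?_⟩
  · have h1 : tan T ≤ n / R := by
      rw [tan_eq_sin_div_cos, div_le_div_iff₀ hcT (by linarith)]
      nlinarith [sin_le_one T]
    calc _ ≤ D / n * (n / R) := mul_le_mul_of_nonneg_left h1 (by positivity)
      _ = _ := by field_simp
  have hct : cos T ≤ cos t := cos_le_cos_of_nonneg_of_le_pi ht.1 (by linarith [pi_pos]) ht.2
  have hct0 : 0 < cos t := hcT.trans_le hct
  have hβt : β * R ≤ n * cos t := hc.trans (by gcongr)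
  have h2R : (2 * R) ^ 2 ≤ (n * cos t) ^ 2 := by
    refine pow_le_pow_left₀ (by linarith) ?_ 2
    nlinarith
  refine ⟨(hasDerivAt_tan hct0.ne').const_mul _, ?_, ?_⟩
  · have h1 : ((m : ℝ) ^ 2 - 1 / 4) / cos t ^ 2 ≤ 4 / β ^ 2 * n ^ 2 := by
      rw [div_le_iff₀ (by positivity)]
      have : (β * R) ^ 2 ≤ (n * cos t) ^ 2 :=
        pow_le_pow_left₀ (by nlinarith) hβt 2
      calc _ ≤ (2 * R) ^ 2 := by linarith
        _ = 4 / β ^ 2 * (β * R) ^ 2 := by field_simp; norm_num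
        _ ≤ 4 / β ^ 2 * (n * cos t) ^ 2 := by gcongr
        _ = _ := by ring
    rw [Qlm, mul_pow, hkβ]
    nlinarith
  · have hQ2 : |Qlm'' m t| ≤ 6 * n ^ 2 / cos t ^ 2 := by
      refine (abs_Qlm''_le hm4 (hmM.trans h2R) hct0.ne').trans (le_of_eq ?_)
      field_simp
    have hQ1 : Qlm' m t ^ 2 ≤ 4 * n ^ 4 / cos t ^ 2 := by
      refine (sq_Qlm'_le hm4 (hmM.trans h2R)).trans ?_
      calc _ ≤ 4 * ((n * cos t) ^ 2) ^ 2 * 1 / cos t ^ 6 := by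
            gcongr
            exact sin_sq_le_one t
        _ = _ := by field_simp
    have hlt : |Qlm'' m t| < 7 * n ^ 2 / cos t ^ 2 := by
      refine hQ2.trans_lt ?_
      gcongr
      norm_num
    calc _ < 7 * n ^ 2 / cos t ^ 2 / (4 * (k * n) ^ 3) +
          5 * (4 * n ^ 4 / cos t ^ 2) / (16 * (k * n) ^ 5) :=
          add_lt_add_of_lt_of_le (by gcongr) (by gcongr)
      _ = _ := by
        rw [hD]
        field_simp
        norm_num
        ring

lemma exp_sub_one_le_mul_exp (x : ℝ) : exp x - 1 ≤ x * exp x := by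
  have h : exp (-x) * exp x = 1 := by rw [← exp_add]; simp
  nlinarith [add_one_le_exp (-x), exp_pos x]

lemma eventually_hasWKBErrorBound_near {r : ℕ → ℝ} (hrinf : Tendsto r atTop atTop)
    (hr0 : Tendsto (fun ℓ : ℕ => r ℓ / (ℓ : ℝ)) atTop (nhds 0)) {η : ℝ} (hη0 : 0 < η)
    (hη : η < √2) :
    ∃ D : ℝ, ∀ᶠ ℓ : ℕ in atTop, ∀ m : ℤ, (ℓ : ℝ) - 2 * r ℓ ≤ m → (m : ℝ) ≤ ℓ - r ℓ →
      ∀ T, 0 ≤ T → T ≤ η * √(r ℓ / ℓ) → HasWKBErrorBound ℓ m T (D / r ℓ) := by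
  have hη2 : η ^ 2 < 2 := (lt_sqrt hη0.le).1 hη
  have hκ : 0 < (2 - η ^ 2) / 2 := by linarith
  set k : ℝ := √((2 - η ^ 2) / 2) with hk
  have hk2 : k ^ 2 = (2 - η ^ 2) / 2 := sq_sqrt hκ.le
  have hkpos : 0 < k := sqrt_pos.2 hκ
  refine ⟨η * (25 / (4 * k ^ 3) + 20 / k ^ 5), ?_⟩
  have hsmall : ∀ᶠ ℓ : ℕ in atTop, r ℓ / (ℓ : ℝ) < k ^ 2 / 6 :=
    hr0.eventually_lt_const (by positivity)
  filter_upwards [hrinf.eventually_ge_atTop 1, hsmall, eventually_gt_atTop 0]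
    with ℓ hR hs hℓ m hm hm' T hT0 hT
  have hℓ' : (0 : ℝ) < ℓ := Nat.cast_pos.2 hℓ
  have hx : 0 < r ℓ / (ℓ : ℝ) := div_pos (by linarith) hℓ'
  rw [div_lt_iff₀ hℓ'] at hs
  refine hasWKBErrorBound_of_near (sqrt_pos.2 hx) ?_ hkpos hη0 (by rw [hk2]; ring) hR
    (by linarith) hm hm' hT0 hT
  rw [sq_sqrt hx.le]
  field_simp

lemma eventually_hasWKBErrorBound_far {r : ℕ → ℝ} (hrinf : Tendsto r atTop atTop)
    (hr0 : Tendsto (fun ℓ : ℕ => r ℓ / (ℓ : ℝ)) atTop (nhds 0)) {η : ℝ} (hη : 2 < η) :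
    ∃ D : ℝ, ∀ᶠ ℓ : ℕ in atTop, ∀ m : ℤ, r ℓ ≤ m → (m : ℝ) ≤ 2 * r ℓ →
      ∀ T, 0 ≤ T → T ≤ π / 2 - η * r ℓ / ℓ → HasWKBErrorBound ℓ m T (D / r ℓ) := by
  set β : ℝ := (2 + η) / 2 with hβ
  have hβ2 : 2 < β := by linarith
  have hκ : 0 < 1 - 4 / β ^ 2 := by
    rw [sub_pos, div_lt_one (by positivity)]
    nlinarith
  set k : ℝ := √(1 - 4 / β ^ 2) with hk
  have hk2 : k ^ 2 = 1 - 4 / β ^ 2 := sq_sqrt hκ.le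
  refine ⟨7 / (4 * k ^ 3) + 5 / (4 * k ^ 5), ?_⟩
  have hsmall : ∀ᶠ ℓ : ℕ in atTop, η ^ 3 * (r ℓ / (ℓ : ℝ)) ^ 2 / 6 < η - β := by
    have hβη : 0 < η - β := by linarith
    refine Tendsto.eventually_lt_const hβη ?_
    simpa using ((hr0.pow 2).const_mul (η ^ 3)).div_const 6
  filter_upwards [hrinf.eventually_ge_atTop 1, hsmall, eventually_gt_atTop 0]
    with ℓ hR hs hℓ m hm hm' T hT0 hT
  have hℓ' : (0 : ℝ) < ℓ := Nat.cast_pos.2 hℓ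
  set x : ℝ := r ℓ / (ℓ : ℝ) with hx
  have hxpos : 0 < x := div_pos (by linarith) hℓ'
  have hηx : 0 < η * x := by positivity
  rw [mul_div_assoc] at hT
  refine hasWKBErrorBound_of_far (sqrt_pos.2 hκ) hβ2 hk2 hR hℓ hm hm' hT0 (by linarith) ?_
  have h1 : sin (η * x) ≤ cos T := by
    rw [← cos_pi_div_two_sub]
    exact cos_le_cos_of_nonneg_of_le_pi hT0 (by linarith [pi_pos]) hT
  have h2 := sin_gt_sub_cube hηx
  have h3 : β * x ≤ cos T := by nlinarith
  have h4 : r ℓ = ℓ * x := by rw [hx]; field_simp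
  rw [h4]
  nlinarith

/-- WKB approximation of solutions of `v'' = Q_{ℓ,m} v` on the interval `I`. -/
theorem stmt_12 (r : ℕ → ℝ) (hrpos : ∀ ℓ, 0 < r ℓ)
    (hrinf : Tendsto r atTop atTop)
    (hr0 : Tendsto (fun ℓ : ℕ => r ℓ / (ℓ : ℝ)) atTop (nhds 0))
    (η₁ η₂ : ℝ) (hη₁ : 2 < η₁) (hη₂0 : 0 < η₂) (hη₂ : η₂ < Real.sqrt 2) :
    ∃ C > (0:ℝ), ∃ L : ℕ, 1 ≤ L ∧ ∀ ℓ : ℕ, L ≤ ℓ → ∀ m : ℤ, ∀ I : Set ℝ,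
      (((ℓ : ℝ) - 2 * r ℓ ≤ (m : ℝ) ∧ (m : ℝ) ≤ (ℓ : ℝ) - r ℓ ∧
          I = Set.Ioo (-(η₂ * Real.sqrt (r ℓ / (ℓ : ℝ)))) (η₂ * Real.sqrt (r ℓ / (ℓ : ℝ)))) ∨
        (r ℓ ≤ (m : ℝ) ∧ (m : ℝ) ≤ 2 * r ℓ ∧
          I = Set.Ioo (-(π / 2 - η₁ * r ℓ / (ℓ : ℝ))) (π / 2 - η₁ * r ℓ / (ℓ : ℝ)))) →
      ∀ v v' : ℝ → ℂ,
        (∀ θ ∈ Set.Ioo (-(π / 2)) (π / 2), HasDerivAt v (v' θ) θ) →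
        (∀ θ ∈ Set.Ioo (-(π / 2)) (π / 2), HasDerivAt v' ((Qlm ℓ m θ : ℂ) * v θ) θ) →
      ∀ c : ℂ,
        ((Even ((ℓ : ℤ) + m) ∧ v' 0 = 0 ∧
            c = ((|Qlm ℓ m 0| ^ ((1:ℝ) / 4) : ℝ) : ℂ) * v 0) ∨
          (¬ Even ((ℓ : ℤ) + m) ∧ v 0 = 0 ∧
            c = ((|Qlm ℓ m 0| ^ (-(1:ℝ) / 4) : ℝ) : ℂ) * v' 0)) →
      ∀ θ ∈ I, ‖v θ - c * ((ylm ℓ m θ : ℝ) : ℂ)‖ ≤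
          C / r ℓ * ‖c‖ * |Qlm ℓ m θ| ^ (-(1:ℝ) / 4) := by
  obtain ⟨D₁, h₁⟩ := eventually_hasWKBErrorBound_near hrinf hr0 hη₂0 hη₂
  obtain ⟨D₂, h₂⟩ := eventually_hasWKBErrorBound_far hrinf hr0 hη₁
  set D : ℝ := max (max D₁ D₂) 1 with hD
  have hDpos : 0 < D := lt_max_of_lt_right one_pos
  obtain ⟨L, hL⟩ := eventually_atTop.1 ((h₁.and h₂).and (hrinf.eventually_ge_atTop 1))
  refine ⟨4 * D * exp (2 * D), by positivity, max L 1, le_max_right _ _, ?_⟩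
  intro ℓ hℓ m I hI v v' hv hv' c hc θ hθ
  obtain ⟨⟨h₁, h₂⟩, hR⟩ := hL ℓ (le_of_max_le_left hℓ)
  have hE : HasWKBErrorBound ℓ m |θ| (D / r ℓ) := by
    rcases hI with ⟨hm, hm', rfl⟩ | ⟨hm, hm', rfl⟩
    · refine (h₁ m hm hm' |θ| (abs_nonneg θ) (abs_lt.2 hθ).le).mono ?_
      have := hrpos ℓ
      gcongr
      exact (le_max_left _ _).trans (le_max_left _ _)
    · refine (h₂ m hm hm' |θ| (abs_nonneg θ) (abs_lt.2 hθ).le).mono ?_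
      have := hrpos ℓ
      gcongr
      exact (le_max_right _ _).trans (le_max_left _ _)
  refine (norm_sub_ylm_le hE hv hv' hc).trans ?_
  have hexp : exp (2 * (D / r ℓ)) - 1 ≤ 2 * (D / r ℓ) * exp (2 * D) := by
    refine (exp_sub_one_le_mul_exp _).trans ?_
    have := hrpos ℓ
    gcongr
    exact div_le_self hDpos.le hR
  calc _ ≤ 2 * (‖c‖ * (2 * (D / r ℓ) * exp (2 * D))) * |Qlm ℓ m θ| ^ (-(1:ℝ) / 4) := by gcongr
    _ = _ := by ring
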